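/- Let N ≥ 1 and let D be the N × N real matrix with entries d_{i,j} = i · sin((j-i)π/2) for j > i and d_{i,j} = 0 for j ≤ i (indices 1 ≤ i, j ≤ N). Then for every coefficient vector A = (a_1, …, a_N) ∈ ℝ^N and every nonnegative integer k, the k-th derivative of the polynomial y(x) = Σ_{r=1}^N a_r F_r(x) satisfies y^{(k)}(x) = Σ_{r=1}^N (D^k A)_r F_r(x) for all real x, where (D^k A)_r denotes the r-th entry of the vector D^k A. -/

import Mathlib

open Polynomial Real Matrix

/-- The Fibonacci polynomials: `F 1 = 1`, `F 2 = X`, and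
`F (r+1) = X * F r + F (r-1)` (with the convention `F 0 = 0`). -/
noncomputable def fibPoly : ℕ → Polynomial ℝ
  | 0 => 0
  | 1 => 1
  | (n + 2) => Polynomial.X * fibPoly (n + 1) + fibPoly n

/-- The Fibonacci operational matrix of differentiation: the `N × N` matrix with
(1-indexed) entries `d_{i,j} = i · sin((j-i)π/2)` for `j > i` and `0` for `j ≤ i`. -/
noncomputable def fibD (N : ℕ) : Matrix (Fin N) (Fin N) ℝ :=
  fun i j =>
    if i.1 + 1 < j.1 + 1 then
      ((i.1 + 1 : ℕ) : ℝ) *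
        Real.sin ((((j.1 + 1 : ℕ) : ℝ) - ((i.1 + 1 : ℕ) : ℝ)) * Real.pi / 2)
    else 0

theorem fibPoly_add_two (n : ℕ) : fibPoly (n + 2) = X * fibPoly (n + 1) + fibPoly n := rfl

theorem derivative_fibPoly_add_two_add (n : ℕ) :
    derivative (fibPoly (n + 2)) + derivative (fibPoly n) = ((n : ℝ[X]) + 1) * fibPoly (n + 1) := by
  induction n using Nat.twoStepInduction with
  | zero => simp [fibPoly]
  | one =>
    simp [fibPoly]
    ring
  | more n ih₀ ih₁ =>
    have hd : ∀ m, derivative (fibPoly (m + 2)) =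
        fibPoly (m + 1) + X * derivative (fibPoly (m + 1)) + derivative (fibPoly m) := by
      intro m
      simp [fibPoly_add_two]
    have h₀ := hd n
    have h₂ := hd (n + 2)
    have hF := fibPoly_add_two (n + 1)
    simp only [add_assoc, Nat.reduceAdd] at *
    push_cast at *
    linear_combination h₂ + h₀ + ih₀ + X * ih₁ - ((n : ℝ[X]) + 2) * hF

theorem eval_derivative_fibPoly (n : ℕ) (x : ℝ) :
    (derivative (fibPoly n)).eval x = ∑ m ∈ Finset.range n,
      (m : ℝ) * Real.sin (((n : ℝ) - m) * π / 2) * (fibPoly m).eval x := by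
  induction n using Nat.twoStepInduction with
  | zero => simp [fibPoly]
  | one => simp [fibPoly]
  | more n ih₀ _ =>
    have h := congrArg (Polynomial.eval x) (derivative_fibPoly_add_two_add n)
    have hs : ∀ m : ℕ, Real.sin ((((n + 2 : ℕ) : ℝ) - m) * π / 2) =
        -Real.sin (((n : ℝ) - m) * π / 2) := by
      intro m
      rw [← Real.sin_add_pi]
      congr 1
      push_cast
      ring
    have hs₁ : Real.sin (((n : ℝ) - (n + 1 : ℕ)) * π / 2) = -1 := by
      rw [← Real.sin_pi_div_two, ← Real.sin_neg]
      congr 1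
      push_cast
      ring
    simp only [eval_add, eval_mul, eval_natCast, eval_one] at h
    rw [Finset.sum_range_succ, Finset.sum_range_succ]
    simp only [hs, hs₁, mul_neg, neg_mul, Finset.sum_neg_distrib, ← ih₀, sub_self, zero_mul,
      zero_div, Real.sin_zero]
    push_cast
    linear_combination h

theorem sum_fibD_mul_eval_fibPoly (N : ℕ) (j : Fin N) (x : ℝ) :
    ∑ i : Fin N, fibD N i j * (fibPoly (i.1 + 1)).eval x =
      (derivative (fibPoly (j.1 + 1))).eval x := by
  rw [eval_derivative_fibPoly, Finset.sum_range_succ']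
  simp only [fibD, add_lt_add_iff_right, ite_mul, zero_mul, Nat.cast_zero, add_zero]
  rw [Fin.sum_univ_eq_sum_range (fun i : ℕ => if i < j.1 then
    ((i + 1 : ℕ) : ℝ) * Real.sin ((((j.1 + 1 : ℕ) : ℝ) - ((i + 1 : ℕ) : ℝ)) * π / 2) *
      (fibPoly (i + 1)).eval x else 0) N, ← Finset.sum_filter]
  congr 1
  ext i
  have := j.2
  simp only [Finset.mem_filter, Finset.mem_range]
  omega

theorem deriv_sum_fibPoly (N : ℕ) (A : Fin N → ℝ) :
    deriv (fun t : ℝ => ∑ r : Fin N, A r * (fibPoly (r.1 + 1)).eval t) =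
      fun t : ℝ => ∑ r : Fin N, (fibD N).mulVec A r * (fibPoly (r.1 + 1)).eval t := by
  ext t
  have h : HasDerivAt (fun t : ℝ => ∑ r : Fin N, A r * (fibPoly (r.1 + 1)).eval t)
      (∑ r : Fin N, A r * (derivative (fibPoly (r.1 + 1))).eval t) t :=
    HasDerivAt.fun_sum fun r _ => ((fibPoly (r.1 + 1)).hasDerivAt t).const_mul (A r)
  rw [h.deriv]
  simp only [← sum_fibD_mul_eval_fibPoly, Matrix.mulVec, dotProduct, Finset.mul_sum,
    Finset.sum_mul]
  rw [Finset.sum_comm]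
  exact Finset.sum_congr rfl fun i _ => Finset.sum_congr rfl fun j _ => by ring

/-- For every coefficient vector `A ∈ ℝ^N` and every `k ≥ 0`, the `k`-th derivative of
`y(x) = ∑_{r=1}^N aᵣ Fᵣ(x)` satisfies `y⁽ᵏ⁾(x) = ∑_{r=1}^N (Dᵏ A)ᵣ Fᵣ(x)` for all real `x`. -/
theorem fibPoly_operational_matrix (N : ℕ) (hN : 1 ≤ N) (A : Fin N → ℝ) (k : ℕ) (x : ℝ) :
    deriv^[k] (fun t : ℝ => ∑ r : Fin N, A r * (fibPoly (r.1 + 1)).eval t) x =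
      ∑ r : Fin N, ((fibD N ^ k).mulVec A) r * (fibPoly (r.1 + 1)).eval x := by
  induction k generalizing A with
  | zero => simp
  | succ k ih =>
    rw [Function.iterate_succ_apply, deriv_sum_fibPoly, ih, pow_succ, Matrix.mulVec_mulVec]
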